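/- Let D = A₁(ℂ) be the first Weyl algebra, and set M₀ = D/D∂, M_∞ = D/Dt, and M_α = D/D(E − α) for α ∈ J*. Then the extension groups of left D-modules satisfy: Ext¹_D(M₀, M_∞) ≅ ℂ, Ext¹_D(M_∞, M₀) ≅ ℂ, Ext¹_D(M_α, M_α) ≅ ℂ for every α ∈ J*, and Ext¹_D(M_α, M_β) = 0 for every other ordered pair (α, β) with α, β ∈ J* ∪ {0, ∞} (i.e. Ext¹_D(M₀,M₀) = Ext¹_D(M_∞,M_∞) = 0, Ext¹_D(M_α,M_β) = 0 for distinct α, β ∈ J*, and Ext¹_D(M_α,M₀) = Ext¹_D(M₀,M_α) = Ext¹_D(M_α,M_∞) = Ext¹_D(M_∞,M_α) = 0 for α ∈ J*). -/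

import Mathlib

set_option synthInstance.maxHeartbeats 1000000
set_option maxHeartbeats 1000000

noncomputable section
open Polynomial

/-- The polynomial ring `ℂ[t]`. -/
abbrev PCc := Polynomial ℂ

/-- Multiplication by `t` as a `ℂ`-linear endomorphism of `ℂ[t]`. -/
def tW : Module.End ℂ PCc := LinearMap.mulLeft ℂ (X : PCc)

/-- The derivative `∂ = d/dt` as a `ℂ`-linear endomorphism of `ℂ[t]`. -/
def dW : Module.End ℂ PCc := Polynomial.derivative

/-- The first Weyl algebra `A₁(ℂ)`: the ring of `ℂ`-linear differential operators on
`ℂ[t]`, i.e. the `ℂ`-subalgebra of endomorphisms of `ℂ[t]` generated by multiplication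
by `t` and the derivative `∂`. -/
def Weyl : Subalgebra ℂ (Module.End ℂ PCc) := Algebra.adjoin ℂ {tW, dW}

/-- The first Weyl algebra, as a type. -/
abbrev Wr : Type := ↥Weyl

noncomputable instance (priority := 5000) instWrRing : Ring Wr := inferInstance
noncomputable instance (priority := 5000) instWrSemiring : Semiring Wr := instWrRing.toSemiring

/-- `t` as an element of the Weyl algebra. -/
def tWe : Wr := ⟨tW, Algebra.subset_adjoin (by simp)⟩

/-- `∂` as an element of the Weyl algebra. -/
def dWe : Wr := ⟨dW, Algebra.subset_adjoin (by simp)⟩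

/-- The Euler operator `E = t∂` as an element of the Weyl algebra. -/
def EWe : Wr := tWe * dWe

/-- An endomorphism of `ℂ[t]` is homogeneous of degree `w` if it maps the homogeneous
component spanned by `t^i` into the one spanned by `t^(i+w)` for all `i` (where the
latter is `0` if `i + w < 0`); thus `t^n ∂^m` is homogeneous of degree `n - m`. -/
def WIsHomog (w : ℤ) (P : Module.End ℂ PCc) : Prop :=
  ∀ i : ℕ, ∃ c : ℂ,
    P (X ^ i) = c • (if 0 ≤ (i : ℤ) + w then (X : PCc) ^ ((i : ℤ) + w).toNat else 0)

/-- The homogeneous component of degree `w` of the Weyl algebra. -/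
def Wgr (w : ℤ) : AddSubgroup Wr where
  carrier := {P | WIsHomog w (P : Module.End ℂ PCc)}
  zero_mem' := fun i => ⟨0, by simp⟩
  add_mem' := by
    rintro P Q hP hQ i
    obtain ⟨c, hc⟩ := hP i
    obtain ⟨d, hd⟩ := hQ i
    exact ⟨c + d, by
      show ((P : Module.End ℂ PCc) + Q) (X ^ i) = _
      rw [LinearMap.add_apply, hc, hd, add_smul]⟩
  neg_mem' := by
    rintro P hP i
    obtain ⟨c, hc⟩ := hP i
    exact ⟨-c, by
      show (-(P : Module.End ℂ PCc)) (X ^ i) = _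
      rw [LinearMap.neg_apply, hc, neg_smul]⟩

/-- `J* = {α ∈ ℂ : 0 ≤ Re α < 1, α ≠ 0}`. -/
def Jstar : Set ℂ := {α : ℂ | 0 ≤ α.re ∧ α.re < 1 ∧ α ≠ 0}

/-- The quotient of the Weyl algebra by the left ideal generated by `P`,
as a left module. -/
abbrev WQuot (P : Wr) : Type := Wr ⧸ (Ideal.span {P} : Ideal Wr)

/-- The induced grading on a quotient of the Weyl algebra by a (homogeneous) left
ideal: the component of degree `w` is the image of the component of degree `w` of
the Weyl algebra. -/
def WQgr (P : Wr) (w : ℤ) : AddSubgroup (WQuot P) :=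
  AddSubgroup.map (Ideal.span {P} : Ideal Wr).mkQ.toAddMonoidHom (Wgr w)

open CategoryTheory

instance : HasExt.{1} (ModuleCat.{0} Wr) := by
  letI := HasDerivedCategory.standard (ModuleCat.{0} Wr)
  exact hasExt_of_hasDerivedCategory _

/-- The first Ext group of two left modules over the Weyl algebra, computed in the
category of left `A₁(ℂ)`-modules. -/
abbrev ExtW (M N : Type) [AddCommGroup M] [Module Wr M] [AddCommGroup N] [Module Wr N] :=
  Abelian.Ext (ModuleCat.of Wr M) (ModuleCat.of Wr N) 1

/-- The module `M₀ = D/D∂`. -/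
abbrev M0W : Type := WQuot dWe
/-- The module `M_∞ = D/Dt`. -/
abbrev MinfW : Type := WQuot tWe
/-- The module `M_α = D/D(E - α)`. -/
abbrev MalW (α : ℂ) : Type := WQuot (EWe - algebraMap ℂ Wr α)

section GenExt
universe w
variable {R : Type} [Ring R]

def genSC (P : R) : ShortComplex (ModuleCat.{0} R) :=
  ShortComplex.moduleCatMk (LinearMap.toSpanSingleton R R P) (Ideal.span {P} : Ideal R).mkQ (by
    ext
    simp)

lemma genSC_shortExact (P : R) (hP : ∀ Q : R, Q * P = 0 → Q = 0) : (genSC P).ShortExact where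
  exact := by
    rw [ShortComplex.moduleCat_exact_iff]
    intro x hx
    change (Submodule.Quotient.mk x : R ⧸ (Ideal.span {P} : Ideal R)) = 0 at hx
    obtain ⟨a, ha⟩ := Ideal.mem_span_singleton'.1 ((Submodule.Quotient.mk_eq_zero _).1 hx)
    exact ⟨a, ha⟩
  mono_f := by
    rw [ModuleCat.mono_iff_injective, injective_iff_map_eq_zero]
    intro a ha
    exact hP a ha
  epi_g := by
    rw [ModuleCat.epi_iff_surjective]
    exact Submodule.mkQ_surjective _

lemma genExt [HasExt.{w} (ModuleCat.{0} R)] (P : R) (hP : ∀ Q : R, Q * P = 0 → Q = 0)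
    (N : Type) [AddCommGroup N] [Module R N] :
    ∃ φ : N →+ Abelian.Ext.{w} (ModuleCat.of R (R ⧸ (Ideal.span {P} : Ideal R)))
        (ModuleCat.of R N) 1,
      Function.Surjective φ ∧ ∀ n, φ n = 0 ↔ ∃ m : N, P • m = n := by
  have hS := genSC_shortExact P hP
  let h0 : N →+ Abelian.Ext.{w} (ModuleCat.of R R) (ModuleCat.of R N) 0 :=
    { toFun := fun n => Abelian.Ext.mk₀ (ModuleCat.ofHom (LinearMap.toSpanSingleton R N n))
      map_zero' := by
        rw [Abelian.Ext.mk₀_eq_zero_iff]; ext; simp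
      map_add' := fun a b => by
        rw [← Abelian.Ext.mk₀_add]; congr 1; ext; simp }
  have h0s : Function.Surjective h0 := by
    intro x
    refine ⟨(Abelian.Ext.homEquiv₀ x).hom (1 : R), ?_⟩
    conv_rhs => rw [← Abelian.Ext.mk₀_homEquiv₀_apply x]
    change Abelian.Ext.mk₀ _ = _
    congr 1
    ext
    simp
  have h0i : Function.Injective h0 := by
    rw [injective_iff_map_eq_zero]
    intro n hn
    change Abelian.Ext.mk₀ _ = 0 at hn
    rw [Abelian.Ext.mk₀_eq_zero_iff] at hn
    have := congrArg (fun f => f.hom (1 : R)) hn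
    simpa using this
  have key : ∀ m : N, (Abelian.Ext.mk₀ (genSC P).f).comp (h0 m) (zero_add 0) = h0 (P • m) := by
    intro m
    refine (Abelian.Ext.mk₀_comp_mk₀ (genSC P).f (Y := ModuleCat.of R R)
      (ModuleCat.ofHom (LinearMap.toSpanSingleton R N m))).trans ?_
    refine congrArg Abelian.Ext.mk₀ (ModuleCat.hom_ext ?_)
    refine LinearMap.ext fun (x : R) => ?_
    exact mul_smul x P m
  have hproj : Subsingleton (Abelian.Ext.{w} (ModuleCat.of R R) (ModuleCat.of R N) (0 + 1)) := by
    have : Projective (ModuleCat.of R R) := inferInstance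
    exact Abelian.Ext.subsingleton_of_projective _ _ _
  refine ⟨(hS.extClass.precomp (ModuleCat.of R N) (add_zero 1)).comp h0, ?_, ?_⟩
  · intro x
    obtain ⟨y, hy⟩ := Abelian.Ext.contravariant_sequence_exact₃ hS (ModuleCat.of R N) x
      (hproj.elim _ _) (add_zero 1)
    obtain ⟨n, rfl⟩ := h0s y
    exact ⟨n, hy⟩
  · intro n
    constructor
    · intro hn
      obtain ⟨y, hy⟩ := Abelian.Ext.contravariant_sequence_exact₁ hS (ModuleCat.of R N) (h0 n)
        (add_zero 1) hn
      obtain ⟨m, rfl⟩ := h0s y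
      exact ⟨m, h0i ((key m).symm.trans hy)⟩
    · rintro ⟨m, rfl⟩
      change hS.extClass.comp (h0 (P • m)) (add_zero 1) = 0
      rw [← key m]
      exact hS.extClass_comp_assoc _

lemma genExt_sub [HasExt.{w} (ModuleCat.{0} R)] (P : R) (hP : ∀ Q : R, Q * P = 0 → Q = 0)
    (N : Type) [AddCommGroup N] [Module R N] (h : ∀ n : N, ∃ m : N, P • m = n) :
    Subsingleton (Abelian.Ext.{w} (ModuleCat.of R (R ⧸ (Ideal.span {P} : Ideal R)))
        (ModuleCat.of R N) 1) := by
  obtain ⟨φ, hs, hk⟩ := genExt.{w} P hP N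
  refine ⟨fun a b => ?_⟩
  obtain ⟨a, rfl⟩ := hs a
  obtain ⟨b, rfl⟩ := hs b
  rw [(hk a).2 (h a), (hk b).2 (h b)]

lemma genExt_equiv [HasExt.{w} (ModuleCat.{0} R)] (P : R) (hP : ∀ Q : R, Q * P = 0 → Q = 0)
    (N : Type) [AddCommGroup N] [Module R N] {A : Type} [AddCommGroup A] (l : N →+ A)
    (hl : Function.Surjective l) (h : ∀ n : N, l n = 0 ↔ ∃ m : N, P • m = n) :
    Nonempty (Abelian.Ext.{w} (ModuleCat.of R (R ⧸ (Ideal.span {P} : Ideal R)))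
        (ModuleCat.of R N) 1 ≃+ A) := by
  obtain ⟨φ, hs, hk⟩ := genExt.{w} P hP N
  have hker : φ.ker = l.ker := by
    ext n
    rw [AddMonoidHom.mem_ker, AddMonoidHom.mem_ker, hk, h]
  exact ⟨(QuotientAddGroup.quotientKerEquivOfSurjective φ hs).symm.trans
    ((QuotientAddGroup.quotientAddEquivOfEq hker).trans
      (QuotientAddGroup.quotientKerEquivOfSurjective l hl))⟩
end GenExt

section GenWeyl
variable {A : Type} [Ring A] [Algebra ℂ A] (t d : A)

def twoSub (P R : A) : Submodule ℂ A :=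
  LinearMap.range (LinearMap.mulLeft ℂ P) ⊔ LinearMap.range (LinearMap.mulRight ℂ R)

lemma twoSub_left (P R x : A) : P * x ∈ twoSub P R :=
  Submodule.mem_sup_left ⟨x, rfl⟩

lemma twoSub_right (P R x : A) : x * R ∈ twoSub P R :=
  Submodule.mem_sup_right ⟨x, rfl⟩

lemma mem_twoSub {P R x : A} : x ∈ twoSub P R ↔ ∃ a b : A, P * a + b * R = x := by
  simp [twoSub, Submodule.mem_sup]

/-- if `P * a + b * R = c • x` with `c ≠ 0` then `x` is in `twoSub P R`. -/
lemma twoSub_smul {P R x : A} (a b : A) (c : ℂ) (hc : c ≠ 0) (h : P * a = b * R + c • x) :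
    x ∈ twoSub P R := by
  have : c • x ∈ twoSub P R := by
    have e : c • x = P * a - b * R := by rw [h]; abel
    rw [e]
    exact Submodule.sub_mem _ (twoSub_left P R a) (twoSub_right P R b)
  exact (Submodule.smul_mem_iff _ hc).1 this

def WInd : Prop := ∀ V : Submodule ℂ A, (1 : A) ∈ V → (∀ x ∈ V, t * x ∈ V) →
  (∀ x ∈ V, d * x ∈ V) → ∀ x, x ∈ V

variable {t d}

lemma span_top (hind : WInd t d) (R : A) (S : Set A) (h1 : (1 : A) ∈ S)
    (ht : ∀ s ∈ S, t * s ∈ Submodule.span ℂ S ⊔ LinearMap.range (LinearMap.mulRight ℂ R))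
    (hd : ∀ s ∈ S, d * s ∈ Submodule.span ℂ S ⊔ LinearMap.range (LinearMap.mulRight ℂ R))
    (V : Submodule ℂ A) (hV : S ⊆ V) (hR : ∀ x, x * R ∈ V) (x : A) : x ∈ V := by
  have aux : ∀ a : A,
      (∀ s ∈ S, a * s ∈ Submodule.span ℂ S ⊔ LinearMap.range (LinearMap.mulRight ℂ R)) →
      ∀ x ∈ Submodule.span ℂ S ⊔ LinearMap.range (LinearMap.mulRight ℂ R),
        a * x ∈ Submodule.span ℂ S ⊔ LinearMap.range (LinearMap.mulRight ℂ R) := by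
    intro a ha
    have : Submodule.span ℂ S ⊔ LinearMap.range (LinearMap.mulRight ℂ R) ≤
      (Submodule.span ℂ S ⊔ LinearMap.range (LinearMap.mulRight ℂ R)).comap
        (LinearMap.mulLeft ℂ a) := by
      refine sup_le (Submodule.span_le.2 fun s hs => ha s hs) ?_
      rintro _ ⟨y, rfl⟩
      refine Submodule.mem_sup_right ⟨a * y, ?_⟩
      simp [mul_assoc]
    exact fun x hx => this hx
  have h := hind _ (Submodule.mem_sup_left (Submodule.subset_span h1)) (aux t ht) (aux d hd) x
  refine (sup_le (Submodule.span_le.2 hV) ?_ :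
    Submodule.span ℂ S ⊔ LinearMap.range (LinearMap.mulRight ℂ R) ≤ V) h
  rintro _ ⟨y, rfl⟩
  exact hR y

lemma d_tpow (hc : d * t = t * d + 1) (k : ℕ) :
    d * t ^ (k + 1) = t ^ (k + 1) * d + ((k : ℂ) + 1) • t ^ k := by
  induction k with
  | zero => simp [hc]
  | succ k ih =>
    rw [pow_succ t (k + 1), ← mul_assoc, ih, add_mul, mul_assoc, hc, mul_add, smul_mul_assoc,
      ← pow_succ]
    simp only [mul_one, ← mul_assoc, add_assoc]
    push_cast
    module

lemma t_dpow (hc : d * t = t * d + 1) (k : ℕ) :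
    t * d ^ (k + 1) = d ^ (k + 1) * t + (-((k : ℂ) + 1)) • d ^ k := by
  have hc' : t * d = d * t - 1 := by rw [hc]; abel
  induction k with
  | zero => simp [hc']; abel
  | succ k ih =>
    rw [pow_succ d (k + 1), ← mul_assoc, ih, add_mul, mul_assoc, hc', mul_sub, smul_mul_assoc,
      ← pow_succ]
    simp only [mul_one, ← mul_assoc]
    push_cast
    module

lemma E_tpow (hc : d * t = t * d + 1) (a b : ℂ) (k : ℕ) :
    (t * d - algebraMap ℂ A a) * t ^ k =
      t ^ k * (t * d - algebraMap ℂ A b) + ((k : ℂ) + b - a) • t ^ k := by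
  simp only [Algebra.algebraMap_eq_smul_one, sub_mul, mul_sub, smul_mul_assoc, mul_smul_comm,
    one_mul, mul_one]
  cases k with
  | zero => simp; module
  | succ k =>
    rw [mul_assoc, d_tpow hc, mul_add, mul_smul_comm, ← pow_succ', ← mul_assoc, ← mul_assoc,
      ← pow_succ', ← pow_succ]
    push_cast
    module

lemma E_dpow (hc : d * t = t * d + 1) (a b : ℂ) (k : ℕ) :
    (t * d - algebraMap ℂ A a) * d ^ k =
      d ^ k * (t * d - algebraMap ℂ A b) + (-(k : ℂ) + b - a) • d ^ k := by
  simp only [Algebra.algebraMap_eq_smul_one, sub_mul, mul_sub, smul_mul_assoc, mul_smul_comm,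
    one_mul, mul_one]
  cases k with
  | zero => simp; module
  | succ k =>
    have h1 : t * d * d ^ (k + 1) = t * d ^ (k + 1) * d := by
      rw [mul_assoc, mul_assoc, ← pow_succ, ← pow_succ']
    have h2 : d ^ (k + 1) * (t * d) = t * d ^ (k + 1) * d + ((k : ℂ) + 1) • d ^ (k + 1) := by
      rw [t_dpow hc, add_mul, smul_mul_assoc, ← pow_succ, mul_assoc]
      module
    rw [h1, h2]
    push_cast
    module

lemma E_dpow' (hc : d * t = t * d + 1) (a : ℂ) (k : ℕ) :
    (t * d - algebraMap ℂ A a) * d ^ k =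
      d ^ (k + 1) * t + (-(k : ℂ) - 1 - a) • d ^ k := by
  simp only [Algebra.algebraMap_eq_smul_one, sub_mul, smul_mul_assoc, one_mul]
  rw [mul_assoc, ← pow_succ', t_dpow hc]
  module

lemma E_tpow' (hc : d * t = t * d + 1) (a : ℂ) (k : ℕ) :
    (t * d - algebraMap ℂ A a) * t ^ k =
      t ^ (k + 1) * d + ((k : ℂ) - a) • t ^ k := by
  have := E_tpow hc a 0 k
  rw [this]
  simp [← mul_assoc, ← pow_succ]

lemma d_tpow' (hc : d * t = t * d + 1) (b : ℂ) (k : ℕ) :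
    d * t ^ (k + 1) = t ^ k * (t * d - algebraMap ℂ A b) + ((k : ℂ) + 1 + b) • t ^ k := by
  rw [d_tpow hc]
  simp only [Algebra.algebraMap_eq_smul_one, mul_sub, mul_smul_comm, mul_one]
  rw [← mul_assoc, ← pow_succ]
  module

lemma t_dpow' (hc : d * t = t * d + 1) (b : ℂ) (k : ℕ) :
    t * d ^ (k + 1) = d ^ k * (t * d - algebraMap ℂ A b) + (b - (k : ℂ)) • d ^ k := by
  have := E_dpow hc 0 b k
  simp only [map_zero, sub_zero] at this
  rw [pow_succ', ← mul_assoc, this]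
  module

lemma top0 (hc : d * t = t * d + 1) (hind : WInd t d) (V : Submodule ℂ A)
    (hR : ∀ x, x * d ∈ V) (hV : ∀ k : ℕ, t ^ k ∈ V) (x : A) : x ∈ V := by
  refine span_top hind d (Set.range fun k : ℕ => t ^ k) ⟨0, pow_zero t⟩ ?_ ?_ V ?_ hR x
  · rintro _ ⟨k, rfl⟩
    exact Submodule.mem_sup_left (Submodule.subset_span ⟨k + 1, pow_succ' t k⟩)
  · rintro _ ⟨k, rfl⟩
    cases k with
    | zero => exact Submodule.mem_sup_right ⟨1, by simp⟩
    | succ k =>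
      dsimp only
      rw [d_tpow hc]
      exact add_mem (Submodule.mem_sup_right ⟨_, rfl⟩)
        (Submodule.mem_sup_left (Submodule.smul_mem _ _ (Submodule.subset_span ⟨k, rfl⟩)))
  · rintro _ ⟨k, rfl⟩
    exact hV k

lemma topinf (hc : d * t = t * d + 1) (hind : WInd t d) (V : Submodule ℂ A)
    (hR : ∀ x, x * t ∈ V) (hV : ∀ k : ℕ, d ^ k ∈ V) (x : A) : x ∈ V := by
  refine span_top hind t (Set.range fun k : ℕ => d ^ k) ⟨0, pow_zero d⟩ ?_ ?_ V ?_ hR x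
  · rintro _ ⟨k, rfl⟩
    cases k with
    | zero => exact Submodule.mem_sup_right ⟨1, by simp⟩
    | succ k =>
      dsimp only
      rw [t_dpow hc]
      exact add_mem (Submodule.mem_sup_right ⟨_, rfl⟩)
        (Submodule.mem_sup_left (Submodule.smul_mem _ _ (Submodule.subset_span ⟨k, rfl⟩)))
  · rintro _ ⟨k, rfl⟩
    exact Submodule.mem_sup_left (Submodule.subset_span ⟨k + 1, pow_succ' d k⟩)
  · rintro _ ⟨k, rfl⟩
    exact hV k

lemma topal (hc : d * t = t * d + 1) (hind : WInd t d) (b : ℂ) (V : Submodule ℂ A)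
    (hR : ∀ x, x * (t * d - algebraMap ℂ A b) ∈ V) (hV : ∀ k : ℕ, t ^ k ∈ V)
    (hV' : ∀ k : ℕ, d ^ k ∈ V) (x : A) : x ∈ V := by
  refine span_top hind (t * d - algebraMap ℂ A b)
    ((Set.range fun k : ℕ => t ^ k) ∪ (Set.range fun k : ℕ => d ^ k))
    (Or.inl ⟨0, pow_zero t⟩) ?_ ?_ V ?_ hR x
  · rintro _ (⟨k, rfl⟩ | ⟨k, rfl⟩)
    · exact Submodule.mem_sup_left (Submodule.subset_span (Or.inl ⟨k + 1, pow_succ' t k⟩))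
    · cases k with
      | zero => exact Submodule.mem_sup_left (Submodule.subset_span (Or.inl ⟨1, by simp⟩))
      | succ k =>
        dsimp only
        rw [t_dpow' hc b]
        exact add_mem (Submodule.mem_sup_right ⟨_, rfl⟩)
          (Submodule.mem_sup_left (Submodule.smul_mem _ _
            (Submodule.subset_span (Or.inr ⟨k, rfl⟩))))
  · rintro _ (⟨k, rfl⟩ | ⟨k, rfl⟩)
    · cases k with
      | zero => exact Submodule.mem_sup_left (Submodule.subset_span (Or.inr ⟨1, by simp⟩))
      | succ k =>
        dsimp only
        rw [d_tpow' hc b]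
        exact add_mem (Submodule.mem_sup_right ⟨_, rfl⟩)
          (Submodule.mem_sup_left (Submodule.smul_mem _ _
            (Submodule.subset_span (Or.inl ⟨k, rfl⟩))))
    · exact Submodule.mem_sup_left (Submodule.subset_span (Or.inr ⟨k + 1, pow_succ' d k⟩))
  · rintro _ (⟨k, rfl⟩ | ⟨k, rfl⟩)
    · exact hV k
    · exact hV' k

universe w
lemma ext_sub_of [HasExt.{w} (ModuleCat.{0} A)] (P R : A) (hP : ∀ Q : A, Q * P = 0 → Q = 0)
    (h : ∀ x, x ∈ twoSub P R) :
    Subsingleton (Abelian.Ext.{w} (ModuleCat.of A (A ⧸ (Ideal.span {P} : Ideal A)))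
        (ModuleCat.of A (A ⧸ (Ideal.span {R} : Ideal A))) 1) := by
  refine genExt_sub.{w} P hP _ fun n => ?_
  obtain ⟨x, rfl⟩ := Submodule.Quotient.mk_surjective _ n
  obtain ⟨a, b, hab⟩ := mem_twoSub.1 (h x)
  refine ⟨Submodule.Quotient.mk a, ?_⟩
  rw [← Submodule.Quotient.mk_smul, Submodule.Quotient.eq, Ideal.mem_span_singleton']
  exact ⟨-b, by rw [← hab, smul_eq_mul]; simp⟩

lemma ext_equiv_of [HasExt.{w} (ModuleCat.{0} A)] (P R : A) (hP : ∀ Q : A, Q * P = 0 → Q = 0)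
    (h : ∀ x, x ∈ twoSub P R ⊔ Submodule.span ℂ {(1 : A)}) (l : A →ₗ[ℂ] ℂ) (l1 : l 1 = 1)
    (lP : ∀ x, l (P * x) = 0) (lR : ∀ x, l (x * R) = 0) :
    Nonempty (Abelian.Ext.{w} (ModuleCat.of A (A ⧸ (Ideal.span {P} : Ideal A)))
        (ModuleCat.of A (A ⧸ (Ideal.span {R} : Ideal A))) 1 ≃+ ℂ) := by
  let l' : (A ⧸ (Ideal.span {R} : Ideal A)) →+ ℂ :=
    QuotientAddGroup.lift (Ideal.span {R} : Ideal A).toAddSubgroup l.toAddMonoidHom (by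
      intro x hx
      obtain ⟨b, rfl⟩ := Ideal.mem_span_singleton'.1 hx
      exact lR b)
  have hl' : ∀ x : A, l' (Submodule.Quotient.mk x) = l x := fun x => rfl
  refine genExt_equiv.{w} P hP _ l' ?_ ?_
  · intro c
    refine ⟨Submodule.Quotient.mk (c • 1), ?_⟩
    rw [hl', map_smul, l1]
    simp
  · intro n
    obtain ⟨x, rfl⟩ := Submodule.Quotient.mk_surjective _ n
    constructor
    · intro hx
      rw [hl'] at hx
      obtain ⟨y, hy, z, hz, rfl⟩ := Submodule.mem_sup.1 (h x)
      obtain ⟨c, rfl⟩ := Submodule.mem_span_singleton.1 hz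
      obtain ⟨a, b, rfl⟩ := mem_twoSub.1 hy
      have hc : c = 0 := by simpa [lP, lR, l1] using hx
      subst hc
      refine ⟨Submodule.Quotient.mk a, ?_⟩
      rw [← Submodule.Quotient.mk_smul, Submodule.Quotient.eq, Ideal.mem_span_singleton']
      exact ⟨-b, by rw [smul_eq_mul]; simp⟩
    · rintro ⟨m, hm⟩
      obtain ⟨a, rfl⟩ := Submodule.Quotient.mk_surjective _ m
      rw [← hm, ← Submodule.Quotient.mk_smul, hl']
      exact lP a
end GenWeyl

section WeylSpec

lemma weyl_comm : dWe * tWe = tWe * dWe + 1 := by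
  apply Subtype.ext
  change dW * tW = tW * dW + 1
  refine LinearMap.ext fun f => ?_
  have h1 : ∀ g : PCc, tW g = X * g := fun g => rfl
  have h2 : ∀ g : PCc, dW g = derivative g := fun g => rfl
  rw [LinearMap.add_apply, Module.End.mul_apply, Module.End.mul_apply, Module.End.one_apply,
    h1, h2, h1, h2, derivative_mul, derivative_X]
  ring

lemma weyl_ind : WInd tWe dWe := by
  intro V h1 ht hd
  have key : ∀ (x : Module.End ℂ PCc) (hx : x ∈ Algebra.adjoin ℂ {tW, dW}),
      ∀ y ∈ V, (⟨x, hx⟩ : Wr) * y ∈ V := by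
    intro x hx
    induction hx using Algebra.adjoin_induction with
    | mem x hx =>
      rcases hx with rfl | rfl
      · exact ht
      · exact hd
    | algebraMap r =>
      intro y hy
      have : (⟨algebraMap ℂ (Module.End ℂ PCc) r, Subalgebra.algebraMap_mem _ r⟩ : Wr) * y
          = r • y := (Algebra.smul_def r y).symm
      rw [this]
      exact V.smul_mem r hy
    | add a b ha hb iha ihb =>
      intro y hy
      have := V.add_mem (iha y hy) (ihb y hy)
      rw [← add_mul] at this
      exact this
    | mul a b ha hb iha ihb =>
      intro y hy
      have := iha _ (ihb y hy)
      rw [← mul_assoc] at this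
      exact this
  intro x
  have := key x.1 x.2 1 h1
  rwa [mul_one] at this

/-- coefficient at an integer index -/
def cf (f : PCc) (k : ℤ) : ℂ := if 0 ≤ k then f.coeff k.toNat else 0

lemma cf_nat (f : PCc) (n : ℕ) : cf f n = f.coeff n := by simp [cf]

lemma cf_neg (f : PCc) (k : ℤ) (hk : k < 0) : cf f k = 0 := by simp [cf, hk]

lemma cf_add (f g : PCc) (k : ℤ) : cf (f + g) k = cf f k + cf g k := by
  unfold cf; split_ifs <;> simp

lemma cf_smul (c : ℂ) (f : PCc) (k : ℤ) : cf (c • f) k = c * cf f k := by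
  unfold cf; split_ifs <;> simp

lemma cf_X_mul (f : PCc) (k : ℤ) : cf (X * f) k = cf f (k - 1) := by
  rcases lt_trichotomy k 0 with hk | rfl | hk
  · rw [cf_neg _ _ hk, cf_neg _ _ (by omega)]
  · rw [cf_neg _ _ (by omega : (0 : ℤ) - 1 < 0)]
    simp [cf]
  · obtain ⟨n, rfl⟩ : ∃ n : ℕ, k = n + 1 := ⟨(k - 1).toNat, by omega⟩
    rw [add_sub_cancel_right, cf_nat, ← Nat.cast_succ, cf_nat, coeff_X_mul]

lemma cf_deriv (f : PCc) (k : ℤ) : cf (derivative f) k = ((k : ℂ) + 1) * cf f (k + 1) := by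
  rcases lt_or_ge k 0 with hk | hk
  · rw [cf_neg _ _ hk]
    rcases eq_or_ne k (-1) with rfl | h
    · simp
    · rw [cf_neg _ _ (by omega), mul_zero]
  · lift k to ℕ using hk
    rw [cf_nat, ← Nat.cast_succ, cf_nat, coeff_derivative]
    push_cast
    ring

lemma ext_cf {f g : PCc} (h : ∀ k : ℤ, cf f k = cf g k) : f = g := by
  ext n
  simpa [cf_nat] using h n

def IsSym (Q : Wr) (w : ℤ) (q : ℂ[X]) : Prop :=
  ∀ n : ℕ, q.eval (n : ℂ) = cf (Q.1 (X ^ n)) (n + w)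

lemma sym_uniq {Q : Wr} {w : ℤ} {p q : ℂ[X]} (hp : IsSym Q w p) (hq : IsSym Q w q) : p = q := by
  refine Polynomial.eq_of_infinite_eval_eq p q ?_
  refine (Set.infinite_range_of_injective (Nat.cast_injective (R := ℂ))).mono ?_
  rintro _ ⟨n, rfl⟩
  exact (hp n).trans (hq n).symm

lemma sym_add {P Q : Wr} {w : ℤ} {p q : ℂ[X]} (hp : IsSym P w p) (hq : IsSym Q w q) :
    IsSym (P + Q) w (p + q) := by
  intro n
  change _ = cf (P.1 (X ^ n) + Q.1 (X ^ n)) _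
  rw [eval_add, cf_add, hp n, hq n]

lemma sym_smul {P : Wr} {w : ℤ} {p : ℂ[X]} (c : ℂ) (hp : IsSym P w p) :
    IsSym (c • P) w (C c * p) := by
  intro n
  change _ = cf (c • (P.1 (X ^ n))) _
  rw [eval_mul, eval_C, cf_smul, hp n]

lemma sym_zero (w : ℤ) : IsSym 0 w 0 := by
  intro n
  change _ = cf 0 _
  simp [cf]

lemma sym_one : IsSym 1 0 1 := by
  intro n
  change _ = cf (X ^ n) _
  rw [add_zero, cf_nat]
  simp

lemma sym_one' (w : ℤ) (hw : w ≠ 0) : IsSym 1 w 0 := by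
  intro n
  change _ = cf (X ^ n) _
  rcases lt_or_ge ((n : ℤ) + w) 0 with h | h
  · rw [cf_neg _ _ h]; simp
  · unfold cf
    rw [if_pos h, coeff_X_pow, if_neg (by omega)]; simp

lemma sym_t {Q : Wr} {w : ℤ} {q : ℂ[X]} (hq : IsSym Q (w - 1) q) : IsSym (tWe * Q) w q := by
  intro n
  change _ = cf (X * Q.1 (X ^ n)) _
  rw [cf_X_mul, hq n]
  congr 1; ring

lemma sym_d {Q : Wr} {w : ℤ} {q : ℂ[X]} (hq : IsSym Q (w + 1) q) :
    IsSym (dWe * Q) w ((X + C ((w : ℂ) + 1)) * q) := by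
  intro n
  change _ = cf (derivative (Q.1 (X ^ n))) _
  rw [cf_deriv, eval_mul, hq n]
  simp [add_assoc]

/-- the operators all of whose homogeneous components have polynomial symbols -/
def symSub : Submodule ℂ Wr where
  carrier := {Q | ∀ w, ∃ q, IsSym Q w q}
  zero_mem' := fun w => ⟨0, sym_zero w⟩
  add_mem' := by
    intro P Q hP hQ w
    obtain ⟨p, hp⟩ := hP w
    obtain ⟨q, hq⟩ := hQ w
    exact ⟨_, sym_add hp hq⟩
  smul_mem' := by
    intro c P hP w
    obtain ⟨p, hp⟩ := hP w
    exact ⟨_, sym_smul c hp⟩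

lemma sym_exists (Q : Wr) (w : ℤ) : ∃ q, IsSym Q w q := by
  refine weyl_ind symSub ?_ ?_ ?_ Q w
  · intro w
    rcases eq_or_ne w 0 with rfl | h
    · exact ⟨_, sym_one⟩
    · exact ⟨_, sym_one' w h⟩
  · intro Q hQ w
    obtain ⟨q, hq⟩ := hQ (w - 1)
    exact ⟨_, sym_t hq⟩
  · intro Q hQ w
    obtain ⟨q, hq⟩ := hQ (w + 1)
    exact ⟨_, sym_d hq⟩

def sym (Q : Wr) (w : ℤ) : ℂ[X] := (sym_exists Q w).choose

lemma sym_spec (Q : Wr) (w : ℤ) : IsSym Q w (sym Q w) := (sym_exists Q w).choose_spec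

lemma sym_eq {Q : Wr} {w : ℤ} {q : ℂ[X]} (h : IsSym Q w q) : sym Q w = q :=
  sym_uniq (sym_spec Q w) h

def lam (c : ℂ) : Wr →ₗ[ℂ] ℂ where
  toFun Q := (sym Q 0).eval c
  map_add' P Q := by
    rw [sym_eq (sym_add (sym_spec P 0) (sym_spec Q 0)), eval_add]
  map_smul' a P := by
    rw [sym_eq (sym_smul a (sym_spec P 0)), eval_mul, eval_C]; rfl

lemma lam_apply (c : ℂ) (Q : Wr) : lam c Q = (sym Q 0).eval c := rfl

lemma lam_one (c : ℂ) : lam c 1 = 1 := by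
  rw [lam_apply, sym_eq sym_one, eval_one]

lemma lam_t_left (x : Wr) : lam 0 (tWe * x) = 0 := by
  rw [lam_apply, sym_eq (sym_t (sym_spec x (0 - 1)))]
  have := sym_spec x (0 - 1) 0
  rw [cf_neg _ _ (by norm_num)] at this
  simpa using this

lemma lam_d_right (x : Wr) : lam 0 (x * dWe) = 0 := by
  rw [lam_apply]
  have := sym_spec (x * dWe) 0 0
  have h : (x * dWe).1 (X ^ 0) = 0 := by
    change x.1 (derivative (X ^ 0)) = 0
    simp
  rw [h] at this
  simpa [cf] using this

lemma lam_d_left (x : Wr) : lam (-1) (dWe * x) = 0 := by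
  rw [lam_apply, sym_eq (sym_d (sym_spec x (0 + 1)))]
  simp

lemma sym_t_right {Q : Wr} {w : ℤ} {q : ℂ[X]} (hq : IsSym Q (w - 1) q) :
    IsSym (Q * tWe) w (q.comp (X + 1)) := by
  intro n
  have h : (Q * tWe).1 (X ^ n) = Q.1 (X ^ (n + 1)) := by
    change Q.1 (X * X ^ n) = _
    rw [pow_succ']
  rw [h]
  have := hq (n + 1)
  simp only [eval_comp, eval_add, eval_X, eval_one]
  push_cast at this
  rw [this]
  congr 1; ring

lemma lam_t_right (x : Wr) : lam (-1) (x * tWe) = 0 := by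
  rw [lam_apply, sym_eq (sym_t_right (sym_spec x (0 - 1)))]
  have := sym_spec x (0 - 1) 0
  rw [cf_neg _ _ (by norm_num)] at this
  simpa using this

lemma lam_E_left (a : ℂ) (x : Wr) : lam a ((EWe - algebraMap ℂ Wr a) * x) = 0 := by
  have h : (EWe - algebraMap ℂ Wr a) * x = tWe * (dWe * x) + (-a) • x := by
    rw [sub_mul, EWe, mul_assoc, ← Algebra.smul_def, neg_smul, sub_eq_add_neg]
  have h2 := sym_t (sym_d (sym_spec x (0 - 1 + 1)))
  have h3 := sym_smul (-a) (sym_spec x 0)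
  rw [h, lam_apply, sym_eq (sym_add h2 h3)]
  simp

lemma E_apply (a : ℂ) (n : ℕ) :
    (EWe - algebraMap ℂ Wr a).1 (X ^ n) = ((n : ℂ) - a) • (X ^ n : PCc) := by
  change X * derivative (X ^ n) - a • (X ^ n : PCc) = _
  rw [sub_smul]
  congr 1
  cases n with
  | zero => simp
  | succ n =>
    rw [derivative_X_pow, smul_eq_C_mul]
    simp [pow_succ]
    ring

lemma lam_E_right (a : ℂ) (x : Wr) : lam a (x * (EWe - algebraMap ℂ Wr a)) = 0 := by
  have h : IsSym (x * (EWe - algebraMap ℂ Wr a)) 0 ((X - C a) * sym x 0) := by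
    intro n
    change _ = cf (x.1 ((EWe - algebraMap ℂ Wr a).1 (X ^ n))) _
    rw [E_apply, map_smul, cf_smul, eval_mul, sym_spec x 0 n]
    simp
  rw [lam_apply, sym_eq h]
  simp

lemma ext_weyl {Q : Wr} (h : ∀ n : ℕ, Q.1 (X ^ n) = 0) : Q = 0 := by
  apply Subtype.ext
  change Q.1 = 0
  refine Polynomial.lhom_ext' fun n => ?_
  ext1
  change Q.1 (monomial n 1) = 0
  rw [← h n, X_pow_eq_monomial]

lemma inj_t (Q : Wr) (h : Q * tWe = 0) : Q = 0 := by
  have hs : ∀ w, IsSym Q w 0 := by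
    intro w
    have h1 := sym_spec Q w
    have h2 : IsSym (Q * tWe) (w + 1) ((sym Q w).comp (X + 1)) :=
      sym_t_right (by rwa [add_sub_cancel_right])
    rw [h] at h2
    have h3 := sym_uniq h2 (sym_zero _)
    have h4 : sym Q w = 0 := by
      have := congrArg (fun p : ℂ[X] => p.comp (X - 1)) h3
      simpa [comp_assoc] using this
    rwa [h4] at h1
  refine ext_weyl fun n => ext_cf fun k => ?_
  have := hs (k - n) n
  rw [add_sub_cancel] at this
  rw [← this]
  simp [cf]

lemma inj_d (Q : Wr) (h : Q * dWe = 0) : Q = 0 := by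
  refine ext_weyl fun n => ?_
  have h1 : (Q * dWe).1 (X ^ (n + 1)) = 0 := by rw [h]; rfl
  change Q.1 (derivative (X ^ (n + 1))) = 0 at h1
  have h2 : derivative (X ^ (n + 1) : PCc) = ((n : ℂ) + 1) • X ^ n := by
    rw [derivative_X_pow, smul_eq_C_mul]; simp
  rw [h2, map_smul] at h1
  exact (smul_eq_zero.1 h1).resolve_left (Nat.cast_add_one_ne_zero n)

lemma inj_E (a : ℂ) (ha : ∀ n : ℕ, (n : ℂ) - a ≠ 0) (Q : Wr)
    (h : Q * (EWe - algebraMap ℂ Wr a) = 0) : Q = 0 := by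
  refine ext_weyl fun n => ?_
  have h1 : (Q * (EWe - algebraMap ℂ Wr a)).1 (X ^ n) = 0 := by rw [h]; rfl
  change Q.1 ((EWe - algebraMap ℂ Wr a).1 (X ^ n)) = 0 at h1
  rw [E_apply, map_smul] at h1
  exact (smul_eq_zero.1 h1).resolve_left (ha n)

lemma jstar_int {a : ℂ} (ha : a ∈ Jstar) (z : ℤ) : a ≠ z := by
  rintro rfl
  obtain ⟨h1, h2, h3⟩ := ha
  simp only [Complex.intCast_re] at h1 h2
  have h4 : (0 : ℤ) ≤ z := by exact_mod_cast h1
  have h5 : z < 1 := by exact_mod_cast h2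
  apply h3
  have : z = 0 := by omega
  simp [this]

lemma jstar_diff {a b : ℂ} (ha : a ∈ Jstar) (hb : b ∈ Jstar) (hab : a ≠ b) (z : ℤ) :
    (z : ℂ) + b - a ≠ 0 := by
  intro h
  have hr := congrArg Complex.re h
  simp only [Complex.sub_re, Complex.add_re, Complex.intCast_re, Complex.zero_re] at hr
  obtain ⟨h1, h2, -⟩ := ha
  obtain ⟨h3, h4, -⟩ := hb
  have h5 : z < 1 := by
    have : (z : ℝ) < 1 := by linarith
    exact_mod_cast this
  have h6 : -1 < z := by
    have : (-1 : ℝ) < z := by linarith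
    exact_mod_cast this
  have : z = 0 := by omega
  subst this
  apply hab
  simp only [Int.cast_zero, zero_add] at h
  exact (sub_eq_zero.1 h).symm

end WeylSpec

/-- The extensions of the simple graded modules over the first Weyl
algebra: `Ext¹(M₀, M_∞) ≅ ℂ`, `Ext¹(M_∞, M₀) ≅ ℂ`, `Ext¹(M_α, M_α) ≅ ℂ` for `α ∈ J*`,
and all other `Ext¹` groups between members of the family vanish. -/
theorem stmt_2 :
    Nonempty (ExtW M0W MinfW ≃+ ℂ) ∧
    Nonempty (ExtW MinfW M0W ≃+ ℂ) ∧
    (∀ α ∈ Jstar, Nonempty (ExtW (MalW α) (MalW α) ≃+ ℂ)) ∧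
    Subsingleton (ExtW M0W M0W) ∧
    Subsingleton (ExtW MinfW MinfW) ∧
    (∀ α ∈ Jstar, ∀ β ∈ Jstar, α ≠ β → Subsingleton (ExtW (MalW α) (MalW β))) ∧
    (∀ α ∈ Jstar, Subsingleton (ExtW (MalW α) M0W) ∧ Subsingleton (ExtW M0W (MalW α)) ∧
      Subsingleton (ExtW (MalW α) MinfW) ∧ Subsingleton (ExtW MinfW (MalW α))) := by
  have hc := weyl_comm
  have hind := weyl_ind
  have hE : ∀ α ∈ Jstar, ∀ Q : Wr, Q * (EWe - algebraMap ℂ Wr α) = 0 → Q = 0 := by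
    intro α hα
    refine inj_E α fun n h => jstar_int hα n ?_
    rw [sub_eq_zero] at h
    simp [h]
  refine ⟨?_, ?_, ?_, ?_, ?_, ?_, ?_⟩
  · refine ext_equiv_of dWe tWe inj_d ?_ (lam (-1)) (lam_one _) lam_d_left lam_t_right
    refine topinf hc hind _ (fun x => Submodule.mem_sup_left (twoSub_right _ _ x)) fun k => ?_
    cases k with
    | zero => exact Submodule.mem_sup_right (Submodule.subset_span (by simp))
    | succ k =>
      rw [pow_succ']
      exact Submodule.mem_sup_left (twoSub_left _ _ _)
  · refine ext_equiv_of tWe dWe inj_t ?_ (lam 0) (lam_one _) lam_t_left lam_d_right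
    refine top0 hc hind _ (fun x => Submodule.mem_sup_left (twoSub_right _ _ x)) fun k => ?_
    cases k with
    | zero => exact Submodule.mem_sup_right (Submodule.subset_span (by simp))
    | succ k =>
      rw [pow_succ']
      exact Submodule.mem_sup_left (twoSub_left _ _ _)
  · intro α hα
    refine ext_equiv_of _ _ (hE α hα) ?_ (lam α) (lam_one _) (lam_E_left α) (lam_E_right α)
    refine topal hc hind α _ (fun x => Submodule.mem_sup_left (twoSub_right _ _ x)) ?_ ?_
    · intro k
      cases k with
      | zero => exact Submodule.mem_sup_right (Submodule.subset_span (by simp))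
      | succ k =>
        refine Submodule.mem_sup_left (twoSub_smul _ _ _ ?_ (E_tpow hc α α (k + 1)))
        rw [add_sub_cancel_right]
        exact Nat.cast_ne_zero.2 (Nat.succ_ne_zero k)
    · intro k
      cases k with
      | zero => exact Submodule.mem_sup_right (Submodule.subset_span (by simp))
      | succ k =>
        refine Submodule.mem_sup_left (twoSub_smul _ _ _ ?_ (E_dpow hc α α (k + 1)))
        rw [add_sub_cancel_right]
        exact neg_ne_zero.2 (Nat.cast_ne_zero.2 (Nat.succ_ne_zero k))
  · refine ext_sub_of dWe dWe inj_d ?_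
    refine top0 hc hind _ (twoSub_right _ _) fun k => ?_
    exact twoSub_smul _ _ _ (Nat.cast_add_one_ne_zero k) (d_tpow hc k)
  · refine ext_sub_of tWe tWe inj_t ?_
    refine topinf hc hind _ (twoSub_right _ _) fun k => ?_
    exact twoSub_smul _ _ _ (neg_ne_zero.2 (Nat.cast_add_one_ne_zero k)) (t_dpow hc k)
  · intro α hα β hβ hab
    refine ext_sub_of _ _ (hE α hα) ?_
    refine topal hc hind β _ (twoSub_right _ _) (fun k => ?_) (fun k => ?_)
    · refine twoSub_smul _ _ _ ?_ (E_tpow hc α β k)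
      have := jstar_diff hα hβ hab k
      simpa using this
    · refine twoSub_smul _ _ _ ?_ (E_dpow hc α β k)
      have := jstar_diff hα hβ hab (-k)
      simpa using this
  · intro α hα
    refine ⟨?_, ?_, ?_, ?_⟩
    · refine ext_sub_of _ _ (hE α hα) ?_
      refine top0 hc hind _ (twoSub_right _ _) fun k => ?_
      refine twoSub_smul _ _ _ ?_ (E_tpow' hc α k)
      intro h
      refine jstar_int hα k ?_
      push_cast
      linear_combination -h
    · refine ext_sub_of _ _ inj_d ?_
      refine topal hc hind α _ (twoSub_right _ _) (fun k => ?_) (fun k => ?_)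
      · refine twoSub_smul _ _ _ ?_ (d_tpow' hc α k)
        intro h
        refine jstar_int hα (-k - 1) ?_
        push_cast
        linear_combination h
      · cases k with
        | zero =>
          rw [pow_zero, ← pow_zero tWe]
          refine twoSub_smul _ _ _ ?_ (d_tpow' hc α 0)
          intro h
          refine jstar_int hα (-1) ?_
          push_cast at h ⊢
          linear_combination h
        | succ k =>
          rw [pow_succ']
          exact twoSub_left _ _ _
    · refine ext_sub_of _ _ (hE α hα) ?_
      refine topinf hc hind _ (twoSub_right _ _) fun k => ?_
      refine twoSub_smul _ _ _ ?_ (E_dpow' hc α k)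
      intro h
      refine jstar_int hα (-k - 1) ?_
      push_cast
      linear_combination -h
    · refine ext_sub_of _ _ inj_t ?_
      have hk : ∀ k : ℕ, α - (k : ℂ) ≠ 0 := fun k h => jstar_int hα k (by
        push_cast
        linear_combination h)
      refine topal hc hind α _ (twoSub_right _ _) (fun k => ?_) (fun k => ?_)
      · cases k with
        | zero =>
          rw [pow_zero, ← pow_zero dWe]
          exact twoSub_smul _ _ _ (hk 0) (t_dpow' hc α 0)
        | succ k =>
          rw [pow_succ']
          exact twoSub_left _ _ _
      · exact twoSub_smul _ _ _ (hk k) (t_dpow' hc α k)
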